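/- Let X_1,…,X_K be mutually independent finitely-valued random variables and let (X_1,…,X_K,Y,Z) be jointly distributed. Let 𝒦₀ ⊊ 𝒦′ ⊆ 𝒦, write 𝒦̄′ = 𝒦∖𝒦′, 𝒦″ = 𝒦′∖𝒦₀ and 𝒦̄″ = 𝒦̄′ ∪ 𝒦₀. Assume that I(X_{𝒦₀};Y|X_{𝒦∖𝒦₀}) − I(X_{𝒦₀};Z|X_{𝒦̄′}) ≤ 0 and that for every nonempty V ⊆ 𝒦″, I(X_{𝒦₀∪V};Y|X_{𝒦∖(𝒦₀∪V)}) − I(X_{𝒦₀∪V};Z|X_{𝒦̄′}) > 0. Then every rate tuple (R_1^s,R_1^o,…,R_K^s,R_K^o) in 𝓡(X_𝒦,𝒦′) satisfies R_k^s = 0 for all k ∈ 𝒦̄″ and, for every V ⊆ 𝒦″, V′ ⊆ V and W ⊆ 𝒦̄″, ∑_{k∈V} R_k^s + ∑_{k∈V∖V′} R_k^o + ∑_{k∈W} R_k^o ≤ I(X_{V∪W};Y|X_{𝒦∖(V∪W)}) − I(X_{V′};Z|X_{𝒦̄″}); in particular 𝓡(X_𝒦,𝒦′) ⊆ 𝓡(X_𝒦,𝒦″).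 -/

import Mathlib

open scoped Classical

noncomputable section

/-- Probability that random variable `X` takes value `x`, under pmf `p` on a finite sample space. -/
def probOf {Ω α : Type} [Fintype Ω] (p : Ω → ℝ) (X : Ω → α) (x : α) : ℝ :=
  ∑ ω, if X ω = x then p ω else 0

/-- Shannon entropy of a finitely-valued random variable. -/
def Hent {Ω α : Type} [Fintype Ω] [Fintype α] (p : Ω → ℝ) (X : Ω → α) : ℝ :=
  -∑ x, probOf p X x * Real.log (probOf p X x)

/-- Conditional entropy `H(X | C)`. -/
def condHent {Ω α γ : Type} [Fintype Ω] [Fintype α] [Fintype γ]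
    (p : Ω → ℝ) (X : Ω → α) (C : Ω → γ) : ℝ :=
  Hent p (fun ω => (X ω, C ω)) - Hent p C

/-- Conditional mutual information `I(A;B | C)`. -/
def IcondMut {Ω α β γ : Type} [Fintype Ω] [Fintype α] [Fintype β] [Fintype γ]
    (p : Ω → ℝ) (A : Ω → α) (B : Ω → β) (C : Ω → γ) : ℝ :=
  condHent p A C + condHent p B C - condHent p (fun ω => (A ω, B ω)) C

/-- Mutual information `I(A;B)`. -/
def Imut {Ω α β : Type} [Fintype Ω] [Fintype α] [Fintype β]
    (p : Ω → ℝ) (A : Ω → α) (B : Ω → β) : ℝ :=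
  Hent p A + Hent p B - Hent p (fun ω => (A ω, B ω))

/-- `p` is a probability mass function. -/
def IsPMF {Ω : Type} [Fintype Ω] (p : Ω → ℝ) : Prop :=
  (∀ ω, 0 ≤ p ω) ∧ ∑ ω, p ω = 1

/-- The tuple `X_S = (X_k)_{k ∈ S}` as a random variable. -/
def tup {Ω ι : Type} {𝒳 : ι → Type} (X : ∀ k, Ω → 𝒳 k) (S : Finset ι) :
    Ω → ∀ k : S, 𝒳 k.1 :=
  fun ω k => X k.1 ω

/-- The random variables `X_1, …, X_K` are mutually independent. -/
def MutIndep {Ω ι : Type} [Fintype Ω] [Fintype ι] {𝒳 : ι → Type} [∀ k, Fintype (𝒳 k)]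
    (p : Ω → ℝ) (X : ∀ k, Ω → 𝒳 k) : Prop :=
  ∀ x : ∀ k, 𝒳 k, probOf p (fun ω k => X k ω) x = ∏ k, probOf p (X k) (x k)

/-- The rate region `𝓡(X_𝒦, 𝒦′)`. -/
def InRegion {Ω : Type} [Fintype Ω] {K : ℕ} {𝒳 : Fin K → Type} [∀ k, Fintype (𝒳 k)]
    {𝒴 𝒵 : Type} [Fintype 𝒴] [Fintype 𝒵]
    (p : Ω → ℝ) (X : ∀ k, Ω → 𝒳 k) (Y : Ω → 𝒴) (Z : Ω → 𝒵)
    (K' : Finset (Fin K)) (Rs Ro : Fin K → ℝ) : Prop :=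
  (∀ k, 0 ≤ Rs k) ∧ (∀ k, 0 ≤ Ro k) ∧ (∀ k ∈ Finset.univ \ K', Rs k = 0) ∧
    ∀ S ⊆ K', ∀ S' ⊆ S, ∀ T ⊆ Finset.univ \ K',
      ∑ k ∈ S, Rs k + ∑ k ∈ S \ S', Ro k + ∑ k ∈ T, Ro k ≤
        max 0 (IcondMut p (tup X (S ∪ T)) Y (tup X (Finset.univ \ (S ∪ T))) -
               IcondMut p (tup X S') Z (tup X (Finset.univ \ K')))

section Entropy

variable {Ω α β γ : Type} [Fintype Ω] {p : Ω → ℝ}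

lemma probOf_nonneg (hp : IsPMF p) (A : Ω → α) (a : α) : 0 ≤ probOf p A a :=
  Finset.sum_nonneg fun ω _ => by split_ifs <;> simp [hp.1 ω]

lemma probOf_apply_pos (hp : IsPMF p) (A : Ω → α) {ω : Ω} (hω : 0 < p ω) :
    0 < probOf p A (A ω) := by
  refine Finset.sum_pos' (fun ω' _ => ?_) ⟨ω, Finset.mem_univ _, by simpa using hω⟩
  split_ifs <;> simp [hp.1 ω']

lemma sum_probOf_prodMk [Fintype α] (A : Ω → α) (C : Ω → γ) (c : γ) :
    ∑ a, probOf p (fun ω => (A ω, C ω)) (a, c) = probOf p C c := by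
  simp only [probOf, Prod.mk.injEq]
  rw [Finset.sum_comm]
  refine Finset.sum_congr rfl fun ω _ => ?_
  by_cases h : C ω = c <;> simp [h]

variable [Fintype α] [Fintype β] [Fintype γ]

lemma sum_mul_comp (A : Ω → α) (G : α → ℝ) :
    ∑ ω, p ω * G (A ω) = ∑ a, probOf p A a * G a := by
  simp only [probOf, Finset.sum_mul, ite_mul, zero_mul]
  rw [Finset.sum_comm]
  simp

lemma sum_probOf (A : Ω → α) : ∑ a, probOf p A a = ∑ ω, p ω := by
  simpa using (sum_mul_comp (p := p) A fun _ => 1).symm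

lemma Hent_eq_sum (A : Ω → α) :
    Hent p A = -∑ ω, p ω * Real.log (probOf p A (A ω)) := by
  rw [Hent, sum_mul_comp A fun a => Real.log (probOf p A a)]

/-- Entropy depends only on the partition of the sample space induced by the variable. -/
lemma Hent_congr {A : Ω → α} {B : Ω → β} (h : ∀ ω ω', A ω = A ω' ↔ B ω = B ω') :
    Hent p A = Hent p B := by
  simp only [Hent_eq_sum, probOf, h]

lemma Hent_of_subsingleton [Subsingleton α] (hp : IsPMF p) (A : Ω → α) : Hent p A = 0 := by
  have h (ω : Ω) : probOf p A (A ω) = 1 := by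
    simp [probOf, Subsingleton.elim _ (A ω), hp.2]
  simp [Hent_eq_sum, h]

/-- Strong subadditivity of entropy. -/
lemma Hent_add_Hent_le (hp : IsPMF p) (A : Ω → α) (B : Ω → β) (C : Ω → γ) :
    Hent p (fun ω => (A ω, B ω, C ω)) + Hent p C ≤
      Hent p (fun ω => (A ω, C ω)) + Hent p (fun ω => (B ω, C ω)) := by
  set P := probOf p (fun ω => (A ω, B ω, C ω)) with hP
  set PA := probOf p (fun ω => (A ω, C ω)) with hPA
  set PB := probOf p (fun ω => (B ω, C ω)) with hPB
  set PC := probOf p C with hPC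
  have hP0 : ∀ x, 0 ≤ P x := probOf_nonneg hp _
  have hPA0 : ∀ x, 0 ≤ PA x := probOf_nonneg hp _
  have hPB0 : ∀ x, 0 ≤ PB x := probOf_nonneg hp _
  have hPC0 : ∀ x, 0 ≤ PC x := probOf_nonneg hp _
  let G : α × β × γ → ℝ := fun x =>
    PA (x.1, x.2.2) * PB (x.2.1, x.2.2) / (P x * PC x.2.2)
  have hpt (ω : Ω) :
      p ω * Real.log (PA (A ω, C ω)) + p ω * Real.log (PB (B ω, C ω))
        - p ω * Real.log (P (A ω, B ω, C ω)) - p ω * Real.log (PC (C ω)) ≤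
      p ω * G (A ω, B ω, C ω) - p ω := by
    rcases (hp.1 ω).eq_or_lt with h | h
    · simp [← h]
    have h1 : 0 < P (A ω, B ω, C ω) := probOf_apply_pos hp (fun ω => (A ω, B ω, C ω)) h
    have h2 : 0 < PA (A ω, C ω) := probOf_apply_pos hp (fun ω => (A ω, C ω)) h
    have h3 : 0 < PB (B ω, C ω) := probOf_apply_pos hp (fun ω => (B ω, C ω)) h
    have h4 : 0 < PC (C ω) := probOf_apply_pos hp C h
    have hG : 0 < G (A ω, B ω, C ω) := by positivity
    have hlog := Real.log_le_sub_one_of_pos hG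
    have hexp : Real.log (G (A ω, B ω, C ω)) = Real.log (PA (A ω, C ω)) +
        Real.log (PB (B ω, C ω)) - (Real.log (P (A ω, B ω, C ω)) + Real.log (PC (C ω))) := by
      rw [Real.log_div (by positivity) (by positivity), Real.log_mul h2.ne' h3.ne',
        Real.log_mul h1.ne' h4.ne']
    rw [hexp] at hlog
    nlinarith [mul_le_mul_of_nonneg_left hlog h.le]
  have hG : ∑ ω, p ω * G (A ω, B ω, C ω) ≤ 1 := by
    calc ∑ ω, p ω * G (A ω, B ω, C ω) = ∑ x, P x * G x :=
          sum_mul_comp (fun ω => (A ω, B ω, C ω)) G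
      _ ≤ ∑ x : α × β × γ, PA (x.1, x.2.2) * PB (x.2.1, x.2.2) / PC x.2.2 := by
          refine Finset.sum_le_sum fun x _ => ?_
          have hnn : 0 ≤ PA (x.1, x.2.2) * PB (x.2.1, x.2.2) / PC x.2.2 :=
            div_nonneg (mul_nonneg (hPA0 _) (hPB0 _)) (hPC0 _)
          rcases (hP0 x).eq_or_lt with h | h
          · simpa [← h] using hnn
          · simp only [G]
            rw [mul_div_assoc', mul_div_mul_left _ _ h.ne']
      _ = ∑ c, (∑ a, PA (a, c)) * (∑ b, PB (b, c)) / PC c := by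
          simp only [Fintype.sum_prod_type, Finset.sum_mul_sum, Finset.sum_div]
          rw [Finset.sum_comm' (t' := Finset.univ) (s' := fun _ => Finset.univ) (by simp)]
          rw [Finset.sum_congr rfl fun b _ => Finset.sum_comm, Finset.sum_comm]
          exact Finset.sum_congr rfl fun c _ => Finset.sum_comm
      _ = ∑ c, PC c := by
          refine Finset.sum_congr rfl fun c _ => ?_
          rw [hPA, hPB, sum_probOf_prodMk, sum_probOf_prodMk, mul_self_div_self]
      _ = 1 := by rw [hPC, sum_probOf, hp.2]
  have hsum := Finset.sum_le_sum fun ω (_ : ω ∈ Finset.univ) => hpt ω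
  simp only [Finset.sum_sub_distrib, Finset.sum_add_distrib, hp.2] at hsum
  simp only [Hent_eq_sum]
  linarith

end Entropy

section Tuples

lemma tup_eq_tup_iff {Ω ι : Type} {𝒳 : ι → Type} (X : ∀ k, Ω → 𝒳 k) (S : Finset ι) (ω ω' : Ω) :
    tup X S ω = tup X S ω' ↔ ∀ k ∈ S, X k ω = X k ω' := by
  simp [tup, funext_iff]

variable {Ω 𝒴 : Type} [Fintype Ω] [Fintype 𝒴] {K : ℕ} {𝒳 : Fin K → Type}
  [∀ k, Fintype (𝒳 k)] {p : Ω → ℝ}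

lemma Hent_prodMk_tup (X : ∀ k, Ω → 𝒳 k) (S T : Finset (Fin K)) :
    Hent p (fun ω => (tup X S ω, tup X T ω)) = Hent p (tup X (S ∪ T)) :=
  Hent_congr fun ω ω' => by
    simp only [Prod.mk.injEq, tup_eq_tup_iff, Finset.mem_union, or_imp, forall_and]

/-- Conditional mutual information between a subtuple and `Y`, through joint entropies. -/
lemma IcondMut_tup (X : ∀ k, Ω → 𝒳 k) (Y : Ω → 𝒴) (S T : Finset (Fin K)) :
    IcondMut p (tup X S) Y (tup X T) =
      (Hent p (fun ω => (Y ω, tup X T ω)) - Hent p (tup X T)) -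
        (Hent p (fun ω => (Y ω, tup X (S ∪ T) ω)) - Hent p (tup X (S ∪ T))) := by
  have h : Hent p (fun ω => ((tup X S ω, Y ω), tup X T ω)) =
      Hent p (fun ω => (Y ω, tup X (S ∪ T) ω)) :=
    Hent_congr fun ω ω' => by
      simp only [Prod.mk.injEq, tup_eq_tup_iff, Finset.mem_union, or_imp, forall_and]
      tauto
  simp only [IcondMut, condHent, h, Hent_prodMk_tup]
  ring

lemma IcondMut_tup_compl (X : ∀ k, Ω → 𝒳 k) (Y : Ω → 𝒴) (S : Finset (Fin K)) :
    IcondMut p (tup X S) Y (tup X (Finset.univ \ S)) =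
      (Hent p (fun ω => (Y ω, tup X (Finset.univ \ S) ω)) - Hent p (tup X (Finset.univ \ S))) -
        (Hent p (fun ω => (Y ω, tup X Finset.univ ω)) - Hent p (tup X Finset.univ)) := by
  rw [IcondMut_tup, Finset.union_sdiff_of_subset (Finset.subset_univ S)]

lemma IcondMut_tup_empty (X : ∀ k, Ω → 𝒳 k) (Y : Ω → 𝒴) (T : Finset (Fin K)) :
    IcondMut p (tup X ∅) Y (tup X T) = 0 := by
  rw [IcondMut_tup, Finset.empty_union, sub_self]

lemma IcondMut_tup_nonneg (hp : IsPMF p) (X : ∀ k, Ω → 𝒳 k) (Y : Ω → 𝒴)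
    (S T : Finset (Fin K)) : 0 ≤ IcondMut p (tup X S) Y (tup X T) := by
  have h := Hent_add_Hent_le hp (tup X S) Y (tup X T)
  have h' : Hent p (fun ω => ((tup X S ω, Y ω), tup X T ω)) =
      Hent p (fun ω => (tup X S ω, Y ω, tup X T ω)) :=
    Hent_congr fun ω ω' => by simp only [Prod.mk.injEq, and_assoc]
  simp only [IcondMut, condHent, h']
  linarith

/-- Chain rule for the conditional mutual information of subtuples. -/
lemma IcondMut_tup_union (X : ∀ k, Ω → 𝒳 k) (Y : Ω → 𝒴) (S S' T : Finset (Fin K)) :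
    IcondMut p (tup X (S ∪ S')) Y (tup X T) =
      IcondMut p (tup X S') Y (tup X T) + IcondMut p (tup X S) Y (tup X (T ∪ S')) := by
  have h : S ∪ (T ∪ S') = S ∪ S' ∪ T := by ext; simp; tauto
  rw [IcondMut_tup, IcondMut_tup, IcondMut_tup, h, Finset.union_comm S' T]
  ring

lemma Hent_prodMk_tup_submodular (hp : IsPMF p) (X : ∀ k, Ω → 𝒳 k) (Y : Ω → 𝒴)
    (S T : Finset (Fin K)) :
    Hent p (fun ω => (Y ω, tup X (S ∪ T) ω)) + Hent p (fun ω => (Y ω, tup X (S ∩ T) ω)) ≤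
      Hent p (fun ω => (Y ω, tup X S ω)) + Hent p (fun ω => (Y ω, tup X T ω)) := by
  have h := Hent_add_Hent_le hp (tup X S) (tup X T) (fun ω => (Y ω, tup X (S ∩ T) ω))
  have absorb (U : Finset (Fin K)) (hU : S ∩ T ⊆ U) :
      Hent p (fun ω => (tup X U ω, Y ω, tup X (S ∩ T) ω)) =
        Hent p (fun ω => (Y ω, tup X U ω)) :=
    Hent_congr fun ω ω' => by
      simp only [Prod.mk.injEq, tup_eq_tup_iff]
      exact ⟨fun h => ⟨h.2.1, h.1⟩, fun h => ⟨h.2, h.1, fun k hk => h.2 k (hU hk)⟩⟩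
  have h3 : Hent p (fun ω => (tup X S ω, tup X T ω, Y ω, tup X (S ∩ T) ω)) =
      Hent p (fun ω => (Y ω, tup X (S ∪ T) ω)) :=
    Hent_congr fun ω ω' => by
      simp only [Prod.mk.injEq, tup_eq_tup_iff, Finset.mem_union, or_imp, forall_and]
      exact ⟨fun h => ⟨h.2.2.1, h.1, h.2.1⟩,
        fun h => ⟨h.2.1, h.2.2, h.1, fun k hk => h.2.1 k (Finset.mem_inter.1 hk).1⟩⟩
  rwa [absorb S Finset.inter_subset_left, absorb T Finset.inter_subset_right, h3] at h

lemma Hent_tup_union_le (hp : IsPMF p) (X : ∀ k, Ω → 𝒳 k) (S T : Finset (Fin K)) :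
    Hent p (tup X (S ∪ T)) ≤ Hent p (tup X S) + Hent p (tup X T) := by
  have h := Hent_add_Hent_le hp (tup X S) (tup X T) (fun _ => ())
  have h1 : Hent p (fun ω => (tup X S ω, tup X T ω, ())) = Hent p (tup X (S ∪ T)) := by
    rw [← Hent_prodMk_tup]
    exact Hent_congr fun ω ω' => by simp only [Prod.mk.injEq, and_true]
  have h2 (U : Finset (Fin K)) : Hent p (fun ω => (tup X U ω, ())) = Hent p (tup X U) :=
    Hent_congr fun ω ω' => by simp only [Prod.mk.injEq, and_true]
  rw [h1, h2, h2, Hent_of_subsingleton hp fun _ => ()] at h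
  linarith

lemma Hent_tup_le_sum (hp : IsPMF p) (X : ∀ k, Ω → 𝒳 k) (S : Finset (Fin K)) :
    Hent p (tup X S) ≤ ∑ k ∈ S, Hent p (X k) := by
  induction S using Finset.induction_on with
  | empty => simp [Hent_of_subsingleton hp]
  | insert k S hk ih =>
    have h := Hent_tup_union_le hp X {k} S
    have h1 : Hent p (tup X {k}) = Hent p (X k) :=
      Hent_congr fun ω ω' => by simp [tup_eq_tup_iff]
    rw [Finset.sum_insert hk, Finset.insert_eq]
    linarith

lemma Hent_tup_univ (hp : IsPMF p) (X : ∀ k, Ω → 𝒳 k) (hind : MutIndep p X) :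
    Hent p (tup X Finset.univ) = ∑ k, Hent p (X k) := by
  have h : Hent p (tup X Finset.univ) = Hent p (fun ω k => X k ω) :=
    Hent_congr fun ω ω' => by
      rw [tup_eq_tup_iff, funext_iff]
      simp only [Finset.mem_univ, true_imp_iff]
  simp only [h, Hent_eq_sum]
  rw [Finset.sum_neg_distrib, Finset.sum_comm]
  refine congrArg _ (Finset.sum_congr rfl fun ω _ => ?_)
  rcases (hp.1 ω).eq_or_lt with h0 | h0
  · simp [← h0]
  · rw [hind, Real.log_prod fun k _ => (probOf_apply_pos hp (X k) h0).ne', Finset.mul_sum]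

lemma Hent_tup_eq_sum (hp : IsPMF p) (X : ∀ k, Ω → 𝒳 k) (hind : MutIndep p X)
    (S : Finset (Fin K)) : Hent p (tup X S) = ∑ k ∈ S, Hent p (X k) := by
  refine le_antisymm (Hent_tup_le_sum hp X S) ?_
  have h1 := Hent_tup_union_le hp X (Finset.univ \ S) S
  rw [Finset.sdiff_union_of_subset (Finset.subset_univ S), Hent_tup_univ hp X hind] at h1
  have h2 := Hent_tup_le_sum hp X (Finset.univ \ S)
  have h3 := Finset.sum_sdiff (f := fun k => Hent p (X k)) (Finset.subset_univ S)
  linarith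

lemma IcondMut_tup_mono (hp : IsPMF p) (X : ∀ k, Ω → 𝒳 k) (Y : Ω → 𝒴)
    {S S' : Finset (Fin K)} (h : S ⊆ S') :
    IcondMut p (tup X S) Y (tup X (Finset.univ \ S)) ≤
      IcondMut p (tup X S') Y (tup X (Finset.univ \ S')) := by
  have h1 := IcondMut_tup_union (p := p) X Y S (S' \ S) (Finset.univ \ S')
  have h2 : Finset.univ \ S' ∪ S' \ S = Finset.univ \ S := by
    ext k; have := @h k; simp; tauto
  rw [Finset.union_sdiff_of_subset h, h2] at h1
  linarith [IcondMut_tup_nonneg hp X Y (S' \ S) (Finset.univ \ S')]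

lemma IcondMut_tup_submodular (hp : IsPMF p) (X : ∀ k, Ω → 𝒳 k) (hind : MutIndep p X)
    (Y : Ω → 𝒴) (S T : Finset (Fin K)) :
    IcondMut p (tup X (S ∪ T)) Y (tup X (Finset.univ \ (S ∪ T))) +
        IcondMut p (tup X (S ∩ T)) Y (tup X (Finset.univ \ (S ∩ T))) ≤
      IcondMut p (tup X S) Y (tup X (Finset.univ \ S)) +
        IcondMut p (tup X T) Y (tup X (Finset.univ \ T)) := by
  have h := Hent_prodMk_tup_submodular hp X Y (Finset.univ \ S) (Finset.univ \ T)
  have hmod := Finset.sum_union_inter (s₁ := Finset.univ \ S) (s₂ := Finset.univ \ T)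
    (f := fun k => Hent p (X k))
  rw [← Finset.sdiff_inter_distrib_right, ← Finset.sdiff_union_distrib] at h hmod
  rw [IcondMut_tup_compl, IcondMut_tup_compl, IcondMut_tup_compl, IcondMut_tup_compl]
  simp only [Hent_tup_eq_sum hp X hind]
  linarith

end Tuples

theorem stmt10 {K : ℕ} (hK : 1 ≤ K) {Ω : Type} [Fintype Ω]
    {𝒳 : Fin K → Type} [∀ k, Fintype (𝒳 k)] {𝒴 𝒵 : Type} [Fintype 𝒴] [Fintype 𝒵]
    (p : Ω → ℝ) (hp : IsPMF p)
    (X : ∀ k, Ω → 𝒳 k) (Y : Ω → 𝒴) (Z : Ω → 𝒵) (hind : MutIndep p X)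
    (K₀ K' : Finset (Fin K)) (hK₀ : K₀ ⊂ K')
    (h1 : IcondMut p (tup X K₀) Y (tup X (Finset.univ \ K₀)) -
            IcondMut p (tup X K₀) Z (tup X (Finset.univ \ K')) ≤ 0)
    (h2 : ∀ V ⊆ K' \ K₀, V.Nonempty →
      0 < IcondMut p (tup X (K₀ ∪ V)) Y (tup X (Finset.univ \ (K₀ ∪ V))) -
            IcondMut p (tup X (K₀ ∪ V)) Z (tup X (Finset.univ \ K')))
    (Rs Ro : Fin K → ℝ) (hmem : InRegion p X Y Z K' Rs Ro) :
    (∀ k ∈ (Finset.univ \ K') ∪ K₀, Rs k = 0) ∧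
    (∀ V ⊆ K' \ K₀, ∀ V' ⊆ V, ∀ W ⊆ (Finset.univ \ K') ∪ K₀,
      ∑ k ∈ V, Rs k + ∑ k ∈ V \ V', Ro k + ∑ k ∈ W, Ro k ≤
        IcondMut p (tup X (V ∪ W)) Y (tup X (Finset.univ \ (V ∪ W))) -
          IcondMut p (tup X V') Z (tup X ((Finset.univ \ K') ∪ K₀))) ∧
    InRegion p X Y Z (K' \ K₀) Rs Ro := by
  obtain ⟨hs, ho, hs0, hR⟩ := hmem
  have hK₀K' := hK₀.1
  have hcompl : Finset.univ \ (K' \ K₀) = (Finset.univ \ K') ∪ K₀ := by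
    ext k; have := @hK₀K' k; simp; tauto
  have hnonnegY (S T : Finset (Fin K)) := IcondMut_tup_nonneg hp X Y S T
  have hsK₀ : ∀ k ∈ K₀, Rs k = 0 := by
    have h := hR K₀ hK₀K' K₀ subset_rfl ∅ (Finset.empty_subset _)
    rw [Finset.sdiff_self, Finset.sum_empty, add_zero, add_zero, Finset.union_empty,
      max_eq_left h1] at h
    exact (Finset.sum_eq_zero_iff_of_nonneg fun k _ => hs k).1
      (le_antisymm h (Finset.sum_nonneg fun k _ => hs k))
  have hsC : ∀ k ∈ (Finset.univ \ K') ∪ K₀, Rs k = 0 := fun k hk =>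
    (Finset.mem_union.1 hk).elim (hs0 k) (hsK₀ k)
  have hmain : ∀ V ⊆ K' \ K₀, ∀ V' ⊆ V, ∀ W ⊆ (Finset.univ \ K') ∪ K₀,
      ∑ k ∈ V, Rs k + ∑ k ∈ V \ V', Ro k + ∑ k ∈ W, Ro k ≤
        IcondMut p (tup X (V ∪ W)) Y (tup X (Finset.univ \ (V ∪ W))) -
          IcondMut p (tup X V') Z (tup X ((Finset.univ \ K') ∪ K₀)) := by
    intro V hV V' hV' W hW
    have hVK' : V ⊆ K' := hV.trans Finset.sdiff_subset
    have hVK₀ : Disjoint V K₀ := Finset.disjoint_of_subset_left hV Finset.sdiff_disjoint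
    have hVmem := fun k (hk : k ∈ V) => Finset.mem_sdiff.1 (hV hk)
    have hWsplit : ∑ k ∈ W, Ro k = ∑ k ∈ W ∩ K₀, Ro k + ∑ k ∈ W \ K₀, Ro k :=
      (Finset.sum_inter_add_sum_sdiff W K₀ Ro).symm
    have hWA : W \ K₀ ⊆ Finset.univ \ K' := by
      intro k hk
      obtain ⟨hk1, hk2⟩ := Finset.mem_sdiff.1 hk
      exact (Finset.mem_union.1 (hW hk1)).resolve_right hk2
    have hW₀ : W ∩ K₀ ⊆ K₀ := Finset.inter_subset_right
    have hsW₀ : ∑ k ∈ W ∩ K₀, Rs k = 0 := Finset.sum_eq_zero fun k hk => hsK₀ k (hW₀ hk)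
    rcases V'.eq_empty_or_nonempty with rfl | hne
    · have h := hR (V ∪ W ∩ K₀) (Finset.union_subset hVK' (hW₀.trans hK₀K')) ∅
        (Finset.empty_subset _) (W \ K₀) hWA
      have hU : V ∪ W ∩ K₀ ∪ W \ K₀ = V ∪ W := by ext; simp; tauto
      have hdisj : Disjoint V (W ∩ K₀) := hVK₀.mono_right hW₀
      rw [hU, IcondMut_tup_empty, sub_zero, max_eq_right (hnonnegY _ _), Finset.sdiff_empty,
        Finset.sum_union hdisj, Finset.sum_union hdisj, hsW₀] at h
      rw [IcondMut_tup_empty, Finset.sdiff_empty]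
      linarith
    · have h := hR (V ∪ K₀) (Finset.union_subset hVK' hK₀K') (V' ∪ K₀)
        (Finset.union_subset_union_left hV') (W \ K₀) hWA
      have hw := hR (W ∩ K₀) (hW₀.trans hK₀K') ∅ (Finset.empty_subset _) ∅
        (Finset.empty_subset _)
      have hsub := IcondMut_tup_submodular hp X hind Y (V ∪ W) K₀
      have hU : V ∪ K₀ ∪ W \ K₀ = V ∪ W ∪ K₀ := by ext; simp; tauto
      have hI : (V ∪ W) ∩ K₀ = W ∩ K₀ := by
        rw [Finset.union_inter_distrib_right, Finset.disjoint_iff_inter_eq_empty.1 hVK₀,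
          Finset.empty_union]
      have hD : (V ∪ K₀) \ (V' ∪ K₀) = V \ V' := by
        ext k; have := hVmem k; simp; tauto
      have hmono := IcondMut_tup_mono hp X Y (S := K₀ ∪ V') (S' := V ∪ W ∪ K₀)
        (Finset.union_subset Finset.subset_union_right
          ((hV'.trans Finset.subset_union_left).trans Finset.subset_union_left))
      have hpos := h2 V' (hV'.trans hV) hne
      rw [Finset.union_comm K₀ V'] at hmono hpos
      rw [hU, hD, max_eq_right (by linarith), Finset.sum_union hVK₀,
        Finset.sum_eq_zero hsK₀] at h
      rw [IcondMut_tup_empty, sub_zero, max_eq_right (hnonnegY _ _), Finset.sdiff_empty, hsW₀,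
        Finset.union_empty, Finset.sum_empty] at hw
      rw [hI] at hsub
      have hchain := IcondMut_tup_union (p := p) X Z V' K₀ (Finset.univ \ K')
      linarith
  refine ⟨hsC, hmain, hs, ho, by rwa [hcompl], fun S hS S' hS' T hT => ?_⟩
  rw [hcompl] at hT ⊢
  exact (hmain S hS S' hS' T hT).trans (le_max_right _ _)
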